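/- Let N ≥ 10 be an integer. Then for every s ∈ (0,1], ∫₀¹ ω[s·e^{−1/s³}, s](r) dr ≥ N(N−4) / (s·((N−2)² + 2(N−2)·s^N)); consequently ∫₀¹ ω[s·e^{−1/s³}, s](r) dr → +∞ as s → 0⁺. -/

import Mathlib

open MeasureTheory Filter Set

/-- The denominator `D = (N-2)²B^(N-4) - 4A^(N-4) + 2(N-2)Bᴺ(B^(N-4) - A^(N-4))`. -/
noncomputable def DAB (N : ℕ) (A B : ℝ) : ℝ :=
  ((N:ℝ) - 2) ^ 2 * B ^ (N - 4) - 4 * A ^ (N - 4)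
    + 2 * ((N:ℝ) - 2) * B ^ N * (B ^ (N - 4) - A ^ (N - 4))

/-- The explicit radial function `ω[A,B]` of Lemma 2.2. -/
noncomputable def omegaAB (N : ℕ) (A B : ℝ) (r : ℝ) : ℝ :=
  if r < A then
    (N : ℝ) * ((N:ℝ) - 4) * B ^ (N - 2) * A ^ (-2 : ℤ) * r / DAB N A B
  else if r ≤ B then
    ((N : ℝ) * ((N:ℝ) - 2) * B ^ (N - 2) * r ^ (-1 : ℤ)
      - 2 * (N : ℝ) * A ^ (N - 4) * B ^ (N - 2) * r ^ ((3:ℤ) - (N:ℤ))) / DAB N A B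
  else
    ((((N:ℝ) - 2) ^ 2 * B ^ (N - 4) - 4 * A ^ (N - 4)) * r
      + 2 * ((N:ℝ) - 2) * B ^ N * (B ^ (N - 4) - A ^ (N - 4)) * r ^ ((1:ℤ) - (N:ℤ)))
      / DAB N A B

lemma DAB_pos {N : ℕ} (hN : 10 ≤ N) {A B : ℝ} (hA : 0 < A) (hAB : A ≤ B) : 0 < DAB N A B := by
  have hN' : (10 : ℝ) ≤ N := by exact_mod_cast hN
  have hB : 0 < B := hA.trans_le hAB
  have hpow : A ^ (N - 4) ≤ B ^ (N - 4) := pow_le_pow_left₀ hA.le hAB _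
  have hBp : 0 < B ^ (N - 4) := by positivity
  have h1 : 0 ≤ 2 * ((N : ℝ) - 2) * B ^ N * (B ^ (N - 4) - A ^ (N - 4)) :=
    mul_nonneg (mul_nonneg (by linarith) (by positivity)) (by linarith)
  have h2 : 64 * B ^ (N - 4) ≤ ((N : ℝ) - 2) ^ 2 * B ^ (N - 4) :=
    mul_le_mul_of_nonneg_right (by nlinarith) hBp.le
  unfold DAB
  linarith

lemma DAB_le {N : ℕ} (hN : 10 ≤ N) {A B : ℝ} (hA : 0 < A) (hAB : A ≤ B) :
    DAB N A B ≤ B ^ (N - 4) * (((N : ℝ) - 2) ^ 2 + 2 * ((N : ℝ) - 2) * B ^ N) := by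
  have hN' : (10 : ℝ) ≤ N := by exact_mod_cast hN
  have hB : 0 < B := hA.trans_le hAB
  have hAp : 0 < A ^ (N - 4) := by positivity
  have h1 : 0 ≤ 2 * ((N : ℝ) - 2) * B ^ N * A ^ (N - 4) :=
    mul_nonneg (mul_nonneg (by linarith) (by positivity)) hAp.le
  unfold DAB
  linarith

lemma pow_mul_zpow_three_sub_le {N : ℕ} (hN : 4 ≤ N) {A r : ℝ} (hA : 0 < A) (hAr : A ≤ r) :
    A ^ (N - 4) * r ^ ((3 : ℤ) - (N : ℤ)) ≤ r⁻¹ := by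
  have hr : 0 < r := hA.trans_le hAr
  have h : r ^ ((3 : ℤ) - (N : ℤ)) = (r ^ (N - 4))⁻¹ * r⁻¹ := by
    rw [← zpow_natCast, ← zpow_neg, ← zpow_neg_one, ← zpow_add₀ hr.ne']
    congr 1
    push_cast [Nat.cast_sub hN]
    ring
  rw [h, ← mul_assoc]
  refine mul_le_of_le_one_left (by positivity) ?_
  rw [← div_eq_mul_inv]
  exact div_le_one_of_le₀ (pow_le_pow_left₀ hA.le hAr _) (by positivity)

lemma omegaAB_lower_bound {N : ℕ} (hN : 10 ≤ N) {A B r : ℝ} (hA : 0 < A) (hAr : A ≤ r)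
    (hrB : r ≤ B) :
    (N : ℝ) * ((N : ℝ) - 4) * B ^ (N - 2) / DAB N A B * r⁻¹ ≤ omegaAB N A B r := by
  have hD := DAB_pos hN hA (hAr.trans hrB)
  have hB : 0 < B := hA.trans_le (hAr.trans hrB)
  have key := pow_mul_zpow_three_sub_le (by omega : 4 ≤ N) hA hAr
  have key' := mul_le_mul_of_nonneg_left key (by positivity : 0 ≤ 2 * (N : ℝ) * B ^ (N - 2))
  rw [omegaAB, if_neg hAr.not_gt, if_pos hrB, div_mul_eq_mul_div, zpow_neg_one]
  refine div_le_div_of_nonneg_right ?_ hD.le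
  linarith

lemma omegaAB_nonneg {N : ℕ} (hN : 10 ≤ N) {A B r : ℝ} (hA : 0 < A) (hAB : A ≤ B) (hr : 0 ≤ r) :
    0 ≤ omegaAB N A B r := by
  have hN' : (10 : ℝ) ≤ N := by exact_mod_cast hN
  have hD := DAB_pos hN hA hAB
  have hB : 0 < B := hA.trans_le hAB
  have hN4 : 0 ≤ (N : ℝ) - 4 := by linarith
  have hN2 : 0 ≤ (N : ℝ) - 2 := by linarith
  rcases lt_or_ge r A with h | h
  · rw [omegaAB, if_pos h]
    positivity
  rcases le_or_gt r B with h' | h'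
  · refine le_trans ?_ (omegaAB_lower_bound hN hA h h')
    positivity
  · have hpow : A ^ (N - 4) ≤ B ^ (N - 4) := pow_le_pow_left₀ hA.le hAB _
    have hBp : 0 < B ^ (N - 4) := by positivity
    have h2 : 64 * B ^ (N - 4) ≤ ((N : ℝ) - 2) ^ 2 * B ^ (N - 4) :=
      mul_le_mul_of_nonneg_right (by nlinarith) hBp.le
    have h3 : 0 ≤ ((N : ℝ) - 2) ^ 2 * B ^ (N - 4) - 4 * A ^ (N - 4) := by linarith
    have h4 : 0 ≤ B ^ (N - 4) - A ^ (N - 4) := by linarith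
    rw [omegaAB, if_neg h.not_gt, if_neg h'.not_ge]
    positivity

lemma intervalIntegrable_zpow_of_pos {a b : ℝ} (ha : 0 < a) (hab : a ≤ b) (n : ℤ) :
    IntervalIntegrable (fun r : ℝ => r ^ n) volume a b :=
  intervalIntegral.intervalIntegrable_zpow
    (Or.inr (by rw [uIcc_of_le hab]; exact fun h => ha.not_ge h.1))

lemma intervalIntegrable_omegaAB_left (N : ℕ) {A B : ℝ} (hA : 0 < A) :
    IntervalIntegrable (omegaAB N A B) volume 0 A := by
  have h : IntervalIntegrable (fun r : ℝ =>
      (N : ℝ) * ((N : ℝ) - 4) * B ^ (N - 2) * A ^ (-2 : ℤ) * r / DAB N A B) volume 0 A :=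
    (by fun_prop : Continuous _).intervalIntegrable _ _
  refine h.congr_uIoo fun r hr => ?_
  rw [uIoo_of_le hA.le] at hr
  simp only [omegaAB, if_pos hr.2]

lemma intervalIntegrable_omegaAB_middle (N : ℕ) {A B : ℝ} (hA : 0 < A) (hAB : A ≤ B) :
    IntervalIntegrable (omegaAB N A B) volume A B := by
  have h := (((intervalIntegrable_zpow_of_pos hA hAB (-1)).const_mul
    ((N : ℝ) * ((N : ℝ) - 2) * B ^ (N - 2))).sub
    ((intervalIntegrable_zpow_of_pos hA hAB ((3 : ℤ) - (N : ℤ))).const_mul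
    (2 * (N : ℝ) * A ^ (N - 4) * B ^ (N - 2)))).div_const (DAB N A B)
  refine h.congr_uIoo fun r hr => ?_
  rw [uIoo_of_le hAB] at hr
  simp only [omegaAB, if_neg hr.1.not_gt, if_pos hr.2.le]

lemma intervalIntegrable_omegaAB_right (N : ℕ) {A B : ℝ} (hA : 0 < A) (hAB : A ≤ B) (hB : B ≤ 1) :
    IntervalIntegrable (omegaAB N A B) volume B 1 := by
  have hid : IntervalIntegrable (fun r : ℝ => r) volume B 1 := continuous_id.intervalIntegrable _ _
  have h := ((hid.const_mul (((N : ℝ) - 2) ^ 2 * B ^ (N - 4) - 4 * A ^ (N - 4))).add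
    ((intervalIntegrable_zpow_of_pos (hA.trans_le hAB) hB ((1 : ℤ) - (N : ℤ))).const_mul
    (2 * ((N : ℝ) - 2) * B ^ N * (B ^ (N - 4) - A ^ (N - 4))))).div_const (DAB N A B)
  refine h.congr_uIoo fun r hr => ?_
  rw [uIoo_of_le hB] at hr
  simp only [omegaAB, if_neg (hAB.trans hr.1.le).not_gt, if_neg hr.1.not_ge]

lemma log_le_integral_omegaAB {N : ℕ} (hN : 10 ≤ N) {A B : ℝ} (hA : 0 < A) (hAB : A ≤ B)
    (hB : B ≤ 1) :
    (N : ℝ) * ((N : ℝ) - 4) * B ^ (N - 2) / DAB N A B * Real.log (B / A) ≤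
      ∫ r in (0 : ℝ)..1, omegaAB N A B r := by
  have hB0 : 0 < B := hA.trans_le hAB
  have hl := intervalIntegrable_omegaAB_left N (B := B) hA
  have hm := intervalIntegrable_omegaAB_middle N hA hAB
  have hr := intervalIntegrable_omegaAB_right N hA hAB hB
  rw [← intervalIntegral.integral_add_adjacent_intervals (hl.trans hm) hr,
    ← intervalIntegral.integral_add_adjacent_intervals hl hm]
  have h1 : 0 ≤ ∫ r in (0 : ℝ)..A, omegaAB N A B r :=
    intervalIntegral.integral_nonneg hA.le fun r hr => omegaAB_nonneg hN hA hAB hr.1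
  have h3 : 0 ≤ ∫ r in B..1, omegaAB N A B r :=
    intervalIntegral.integral_nonneg hB fun r hr => omegaAB_nonneg hN hA hAB (hB0.le.trans hr.1)
  have hinv : IntervalIntegrable (fun r : ℝ => r⁻¹) volume A B := by
    simpa only [zpow_neg_one] using intervalIntegrable_zpow_of_pos hA hAB (-1)
  have h2 := intervalIntegral.integral_mono_on hAB
    (hinv.const_mul ((N : ℝ) * ((N : ℝ) - 4) * B ^ (N - 2) / DAB N A B)) hm
    fun r hr => omegaAB_lower_bound hN hA hr.1 hr.2
  rw [intervalIntegral.integral_const_mul, integral_inv_of_pos hA hB0] at h2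
  linarith

lemma le_integral_omegaAB_exp {N : ℕ} (hN : 10 ≤ N) {s : ℝ} (hs : s ∈ Set.Ioc (0 : ℝ) 1) :
    (N : ℝ) * ((N : ℝ) - 4) / (s * (((N : ℝ) - 2) ^ 2 + 2 * ((N : ℝ) - 2) * s ^ N)) ≤
      ∫ r in (0 : ℝ)..1, omegaAB N (s * Real.exp (-1 / s ^ 3)) s r := by
  have hN' : (10 : ℝ) ≤ N := by exact_mod_cast hN
  have hs0 : 0 < s := hs.1
  have hA : 0 < s * Real.exp (-1 / s ^ 3) := by positivity
  have hAB : s * Real.exp (-1 / s ^ 3) ≤ s := by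
    refine mul_le_of_le_one_right hs0.le (Real.exp_le_one_iff.2 ?_)
    exact div_nonpos_of_nonpos_of_nonneg (by norm_num) (by positivity)
  have hlog : Real.log (s / (s * Real.exp (-1 / s ^ 3))) = 1 / s ^ 3 := by
    rw [div_mul_cancel_left₀ hs0.ne', Real.log_inv, Real.log_exp]
    ring
  refine le_trans ?_ (log_le_integral_omegaAB hN hA hAB hs.2)
  have hD := DAB_pos hN hA hAB
  have hN4 : 0 ≤ (N : ℝ) - 4 := by linarith
  have hN2 : 0 < (N : ℝ) - 2 := by linarith
  have hpow : s ^ (N - 2) = s ^ (N - 4) * s ^ 2 := by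
    rw [← pow_add]
    congr 1
    omega
  rw [hlog]
  calc (N : ℝ) * ((N : ℝ) - 4) / (s * (((N : ℝ) - 2) ^ 2 + 2 * ((N : ℝ) - 2) * s ^ N))
      = (N : ℝ) * ((N : ℝ) - 4) * s ^ (N - 2) /
          (s ^ (N - 4) * (((N : ℝ) - 2) ^ 2 + 2 * ((N : ℝ) - 2) * s ^ N)) * (1 / s ^ 3) := by
        rw [hpow]
        have hC : ((N : ℝ) - 2) ^ 2 + 2 * ((N : ℝ) - 2) * s ^ N ≠ 0 := by positivity
        generalize ((N : ℝ) - 2) ^ 2 + 2 * ((N : ℝ) - 2) * s ^ N = C at hC ⊢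
        have hp : s ^ (N - 4) ≠ 0 := by positivity
        generalize s ^ (N - 4) = p at hp ⊢
        field_simp
    _ ≤ _ := by
        refine mul_le_mul_of_nonneg_right ?_ (by positivity)
        exact div_le_div_of_nonneg_left (by positivity) hD (DAB_le hN hA hAB)

theorem stmt11 (N : ℕ) (hN : 10 ≤ N) :
    (∀ s ∈ Set.Ioc (0:ℝ) 1,
      (N : ℝ) * ((N:ℝ) - 4)
          / (s * (((N:ℝ) - 2) ^ 2 + 2 * ((N:ℝ) - 2) * s ^ N)) ≤
        ∫ r in (0:ℝ)..1, omegaAB N (s * Real.exp (-1 / s ^ 3)) s r) ∧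
    Tendsto (fun s : ℝ => ∫ r in (0:ℝ)..1, omegaAB N (s * Real.exp (-1 / s ^ 3)) s r)
      (nhdsWithin 0 (Set.Ioi 0)) atTop := by
  refine ⟨fun s hs => le_integral_omegaAB_exp hN hs, ?_⟩
  have hN' : (10 : ℝ) ≤ N := by exact_mod_cast hN
  have hN4 : 0 < (N : ℝ) - 4 := by linarith
  have hN2 : 0 < (N : ℝ) - 2 := by linarith
  have hK : 0 < (N : ℝ) * ((N : ℝ) - 4) / (((N : ℝ) - 2) ^ 2 + 2 * ((N : ℝ) - 2)) := by
    positivity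
  refine tendsto_atTop_mono' _ ?_ (tendsto_inv_nhdsGT_zero.const_mul_atTop hK)
  filter_upwards [Ioc_mem_nhdsGT (zero_lt_one' ℝ)] with s hs
  refine le_trans ?_ (le_integral_omegaAB_exp hN hs)
  have hs0 : 0 < s := hs.1
  have hsN : s ^ N ≤ 1 := pow_le_one₀ hs0.le hs.2
  rw [← div_eq_mul_inv, div_div]
  refine div_le_div_of_nonneg_left (by positivity) (by positivity) ?_
  have hle : 2 * ((N : ℝ) - 2) * s ^ N ≤ 2 * ((N : ℝ) - 2) :=
    mul_le_of_le_one_right (by positivity) hsN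
  rw [mul_comm]
  exact mul_le_mul_of_nonneg_right (by linarith) hs0.le
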